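/- For every m ≥ 1 and all indices j, k ∈ {1,…,m}, the operator Z_{jk} := y_j∂_{x_k} + y_k∂_{x_j} + (multiplication by z_j z_k) commutes with the symplectic Dirac operator: [D_s, Z_{jk}] = 0. -/

import Mathlib

open MvPolynomial Finset

noncomputable section

/-- Polynomials in 3m variables x_1..x_m, y_1..y_m, z_1..z_m. -/
abbrev PS (m : ℕ) : Type := MvPolynomial (Fin m ⊕ Fin m ⊕ Fin m) ℂ

variable (m : ℕ)

/-- partial derivative ∂_{x_j} -/
def dx (j : Fin m) : Module.End ℂ (PS m) := (pderiv (Sum.inl j)).toLinearMap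
/-- partial derivative ∂_{y_j} -/
def dy (j : Fin m) : Module.End ℂ (PS m) := (pderiv (Sum.inr (Sum.inl j))).toLinearMap
/-- partial derivative ∂_{z_j} -/
def dz (j : Fin m) : Module.End ℂ (PS m) := (pderiv (Sum.inr (Sum.inr j))).toLinearMap
/-- multiplication by x_j -/
def mx (j : Fin m) : Module.End ℂ (PS m) := LinearMap.mulLeft ℂ (X (Sum.inl j))
/-- multiplication by y_j -/
def my (j : Fin m) : Module.End ℂ (PS m) := LinearMap.mulLeft ℂ (X (Sum.inr (Sum.inl j)))
/-- multiplication by z_j -/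
def mz (j : Fin m) : Module.End ℂ (PS m) := LinearMap.mulLeft ℂ (X (Sum.inr (Sum.inr j)))

/-- symplectic Dirac operator D_s = ⟨z,∂_y⟩ − ⟨∂_z,∂_x⟩ -/
def Ds : Module.End ℂ (PS m) := (∑ j, mz m j * dy m j) - ∑ j, dz m j * dx m j
/-- adjoint X_s = ⟨y,∂_z⟩ + ⟨x,z⟩ -/
def Xs : Module.End ℂ (PS m) := (∑ j, my m j * dz m j) + ∑ j, mx m j * mz m j
/-- Euler operator in x -/
def Ex : Module.End ℂ (PS m) := ∑ j, mx m j * dx m j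
/-- Euler operator in y -/
def Ey : Module.End ℂ (PS m) := ∑ j, my m j * dy m j
/-- Euler operator in z -/
def Ez : Module.End ℂ (PS m) := ∑ j, mz m j * dz m j
/-- Δ_x -/
def lapX : Module.End ℂ (PS m) := ∑ j, dx m j * dx m j
/-- Δ_y -/
def lapY : Module.End ℂ (PS m) := ∑ j, dy m j * dy m j
/-- Δ_z -/
def lapZ : Module.End ℂ (PS m) := ∑ j, dz m j * dz m j
/-- ⟨∂_x,∂_y⟩ -/
def dxdy : Module.End ℂ (PS m) := ∑ j, dx m j * dy m j
/-- ⟨∂_y,∂_z⟩ -/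
def dydz : Module.End ℂ (PS m) := ∑ j, dy m j * dz m j
/-- ⟨∂_x,∂_z⟩ = ⟨∂_z,∂_x⟩ -/
def dxdz : Module.End ℂ (PS m) := ∑ j, dx m j * dz m j
/-- ⟨x,∂_y⟩ -/
def xdy : Module.End ℂ (PS m) := ∑ j, mx m j * dy m j
/-- ⟨y,∂_x⟩ -/
def ydx : Module.End ℂ (PS m) := ∑ j, my m j * dx m j
/-- ⟨x,∂_z⟩ -/
def xdz : Module.End ℂ (PS m) := ∑ j, mx m j * dz m j
/-- ⟨z,∂_x⟩ -/
def zdx : Module.End ℂ (PS m) := ∑ j, mz m j * dx m j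
/-- ⟨y,∂_z⟩ -/
def ydz : Module.End ℂ (PS m) := ∑ j, my m j * dz m j
/-- ⟨z,∂_y⟩ -/
def zdy : Module.End ℂ (PS m) := ∑ j, mz m j * dy m j
/-- multiplication by |x|² -/
def nx2 : Module.End ℂ (PS m) := ∑ j, mx m j * mx m j
/-- multiplication by |y|² -/
def ny2 : Module.End ℂ (PS m) := ∑ j, my m j * my m j
/-- multiplication by |z|² -/
def nz2 : Module.End ℂ (PS m) := ∑ j, mz m j * mz m j
/-- multiplication by ⟨x,y⟩ -/
def mxy : Module.End ℂ (PS m) := ∑ j, mx m j * my m j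
/-- multiplication by ⟨y,z⟩ -/
def myz : Module.End ℂ (PS m) := ∑ j, my m j * mz m j
/-- multiplication by ⟨x,z⟩ -/
def mxz : Module.End ℂ (PS m) := ∑ j, mx m j * mz m j
/-- L = ⟨x,∂_y⟩ − (1/2)Δ_z -/
def Lop : Module.End ℂ (PS m) := xdy m - (1/2 : ℂ) • lapZ m
/-- R = ⟨y,∂_x⟩ + (1/2)|z|² -/
def Rop : Module.End ℂ (PS m) := ydx m + (1/2 : ℂ) • nz2 m

/-- Z_{jk} := y_j∂_{x_k} + y_k∂_{x_j} + z_j z_k -/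
def Zjk (j k : Fin m) : Module.End ℂ (PS m) :=
  my m j * dx m k + my m k * dx m j + mz m j * mz m k

/-- Partial derivatives of multivariate polynomials commute. -/
theorem MvPolynomial.pderiv_pderiv_comm {R σ : Type*} [CommRing R] (i j : σ)
    (p : MvPolynomial σ R) : pderiv i (pderiv j p) = pderiv j (pderiv i p) := by
  classical
  have h : ⁅pderiv (R := R) i, pderiv (R := R) j⁆ = 0 := by
    ext1 k
    simp [Derivation.commutator_apply, pderiv_X, Pi.single_apply, apply_ite]
  simpa [Derivation.commutator_apply, sub_eq_zero] using congrArg (fun D ↦ D p) h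

theorem dx_mul_my (j k : Fin m) : dx m j * my m k = my m k * dx m j := by
  apply LinearMap.ext
  intro f
  simp [dx, my, pderiv_X]

theorem dx_mul_mz (j k : Fin m) : dx m j * mz m k = mz m k * dx m j := by
  apply LinearMap.ext
  intro f
  simp [dx, mz, pderiv_X]

theorem dy_mul_mz (j k : Fin m) : dy m j * mz m k = mz m k * dy m j := by
  apply LinearMap.ext
  intro f
  simp [dy, mz, pderiv_X]

theorem dz_mul_my (j k : Fin m) : dz m j * my m k = my m k * dz m j := by
  apply LinearMap.ext
  intro f
  simp [dz, my, pderiv_X]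

theorem mz_mul_my (j k : Fin m) : mz m j * my m k = my m k * mz m j := by
  apply LinearMap.ext
  intro f
  simp [mz, my, mul_left_comm]

theorem mz_mul_mz (j k : Fin m) : mz m j * mz m k = mz m k * mz m j := by
  apply LinearMap.ext
  intro f
  simp [mz, mul_left_comm]

theorem dy_mul_my (j k : Fin m) :
    dy m j * my m k = my m k * dy m j + if j = k then 1 else 0 := by
  apply LinearMap.ext
  intro f
  rcases eq_or_ne j k with rfl | h
  · simp [dy, my]
  · simp [dy, my, pderiv_X, h, h.symm]

theorem dz_mul_mz (j k : Fin m) :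
    dz m j * mz m k = mz m k * dz m j + if j = k then 1 else 0 := by
  apply LinearMap.ext
  intro f
  rcases eq_or_ne j k with rfl | h
  · simp [dz, mz]
  · simp [dz, mz, pderiv_X, h, h.symm]

theorem dx_mul_dx (j k : Fin m) : dx m j * dx m k = dx m k * dx m j :=
  LinearMap.ext fun f ↦ pderiv_pderiv_comm _ _ f

theorem dy_mul_dx (j k : Fin m) : dy m j * dx m k = dx m k * dy m j :=
  LinearMap.ext fun f ↦ pderiv_pderiv_comm _ _ f

theorem dz_mul_dx (j k : Fin m) : dz m j * dx m k = dx m k * dz m j :=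
  LinearMap.ext fun f ↦ pderiv_pderiv_comm _ _ f

theorem Ds_mul_my (k : Fin m) : Ds m * my m k = my m k * Ds m + mz m k := by
  have zdy_my (j : Fin m) : mz m j * dy m j * my m k =
      my m k * (mz m j * dy m j) + if j = k then mz m j else 0 := by
    rw [mul_assoc, dy_mul_my, mul_add, ← mul_assoc, mz_mul_my, mul_assoc, mul_ite, mul_one,
      mul_zero]
  have dzdx_my (j : Fin m) : dz m j * dx m j * my m k = my m k * (dz m j * dx m j) := by
    rw [mul_assoc, dx_mul_my, ← mul_assoc, dz_mul_my, mul_assoc]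
  simp_rw [Ds, sub_mul, mul_sub, Finset.sum_mul, Finset.mul_sum, zdy_my, dzdx_my,
    Finset.sum_add_distrib, Finset.sum_ite_eq', Finset.mem_univ, if_true]
  abel

theorem Ds_mul_mz (k : Fin m) : Ds m * mz m k = mz m k * Ds m - dx m k := by
  have zdy_mz (j : Fin m) : mz m j * dy m j * mz m k = mz m k * (mz m j * dy m j) := by
    rw [mul_assoc, dy_mul_mz, ← mul_assoc, mz_mul_mz, mul_assoc]
  have dzdx_mz (j : Fin m) : dz m j * dx m j * mz m k =
      mz m k * (dz m j * dx m j) + if j = k then dx m j else 0 := by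
    rw [mul_assoc, dx_mul_mz, ← mul_assoc, dz_mul_mz, add_mul, mul_assoc, ite_mul, one_mul,
      zero_mul]
  simp_rw [Ds, sub_mul, mul_sub, Finset.sum_mul, Finset.mul_sum, zdy_mz, dzdx_mz,
    Finset.sum_add_distrib, Finset.sum_ite_eq', Finset.mem_univ, if_true]
  abel

theorem Ds_mul_dx (k : Fin m) : Ds m * dx m k = dx m k * Ds m := by
  have zdy_dx (j : Fin m) : mz m j * dy m j * dx m k = dx m k * (mz m j * dy m j) := by
    rw [mul_assoc, dy_mul_dx, ← mul_assoc, ← dx_mul_mz, mul_assoc]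
  have dzdx_dx (j : Fin m) : dz m j * dx m j * dx m k = dx m k * (dz m j * dx m j) := by
    rw [mul_assoc, dx_mul_dx, ← mul_assoc, dz_mul_dx, mul_assoc]
  simp_rw [Ds, sub_mul, mul_sub, Finset.sum_mul, Finset.mul_sum, zdy_dx, dzdx_dx]

/-- [D_s, Z_{jk}] = 0. -/
theorem stmt4 : ∀ m : ℕ, 1 ≤ m → ∀ j k : Fin m, ⁅Ds m, Zjk m j k⁆ = 0 := by
  intro m _ j k
  have my_dx (a b : Fin m) :
      Ds m * (my m a * dx m b) = my m a * dx m b * Ds m + mz m a * dx m b := by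
    rw [← mul_assoc, Ds_mul_my, add_mul, mul_assoc, Ds_mul_dx, mul_assoc]
  have mz_mz : Ds m * (mz m j * mz m k) =
      mz m j * mz m k * Ds m - mz m j * dx m k - mz m k * dx m j := by
    rw [← mul_assoc, Ds_mul_mz, sub_mul, mul_assoc, Ds_mul_mz, mul_sub, dx_mul_mz, mul_assoc]
  rw [Ring.lie_def, Zjk, mul_add, mul_add, my_dx, my_dx, mz_mz, add_mul, add_mul]
  abel
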